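/- Let A and B be unital C*-algebras and let β : A → B and α : B → A be linear, unital, star-preserving, contractive maps satisfying the operator Schwarz inequality (β(x)*β(x) ≤ β(x*x) for all x ∈ A, and α(y)*α(y) ≤ α(y*y) for all y ∈ B). Suppose ‖α(β(x)) − x‖ ≤ ε‖x‖ for all x ∈ A. Then for all n₁, n₂ ∈ A: ‖α(β(n₁)β(n₂)) − n₁n₂‖ ≤ 5ε‖n₁‖‖n₂‖. -/

import Mathlib

open UniformSpace ComplexConjugate

namespace UniformSpace.Completion

section Star

variable {A : Type*} [NormedRing A] [StarRing A] [CStarRing A]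

noncomputable instance instStarCompletion : Star (Completion A) where
  star := Completion.map star

theorem coe_star (a : A) : ((star a : A) : Completion A) = star (a : Completion A) :=
  (Completion.map_coe (starₗᵢ ℤ : A ≃ₗᵢ⋆[ℤ] A).isometry.uniformContinuous a).symm

instance instContinuousStarCompletion : ContinuousStar (Completion A) where
  continuous_star := Completion.continuous_map

noncomputable instance instStarRingCompletion : StarRing (Completion A) where
  star_involutive x := by
    induction x using Completion.induction_on with
    | hp => exact isClosed_eq (by fun_prop) (by fun_prop)
    | ih a => simp [← coe_star]
  star_mul x y := by
    induction x, y using Completion.induction_on₂ with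
    | hp => exact isClosed_eq (by fun_prop) (by fun_prop)
    | ih a b => simp [← coe_star, ← coe_mul]
  star_add x y := by
    induction x, y using Completion.induction_on₂ with
    | hp => exact isClosed_eq (by fun_prop) (by fun_prop)
    | ih a b => simp [← coe_star, ← coe_add]

instance instCStarRingCompletion : CStarRing (Completion A) where
  norm_mul_self_le x := by
    induction x using Completion.induction_on with
    | hp => exact isClosed_le (by fun_prop) (by fun_prop)
    | ih a => simp [← coe_star, ← coe_mul, CStarRing.norm_star_mul_self]

variable [NormedAlgebra ℂ A]

noncomputable instance instNormedAlgebraComplexCompletion : NormedAlgebra ℂ (Completion A) where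
  norm_smul_le := norm_smul_le

variable [StarModule ℂ A]

instance instStarModuleComplexCompletion : StarModule ℂ (Completion A) where
  star_smul c x := by
    induction x using Completion.induction_on with
    | hp =>
      exact isClosed_eq (continuous_star.comp (continuous_const_smul c))
        ((continuous_const_smul (star c)).comp continuous_star)
    | ih a => rw [← coe_smul, ← coe_star, ← coe_star, ← coe_smul, star_smul]

noncomputable instance instCStarAlgebraCompletion : CStarAlgebra (Completion A) where

end Star

end UniformSpace.Completion

/-- In a C⋆-algebra, `-b ≤ a ≤ b` implies `‖a‖ ≤ ‖b‖`. -/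
theorem CStarAlgebra.norm_le_norm_of_add_nonneg_of_sub_nonneg {A : Type*} [CStarAlgebra A]
    [PartialOrder A] [StarOrderedRing A] {a b : A} (hadd : 0 ≤ b + a) (hsub : 0 ≤ b - a) :
    ‖a‖ ≤ ‖b‖ := by
  nontriviality A
  have hb : IsSelfAdjoint b := by
    rw [show b = (2⁻¹ : ℝ) • ((b + a) + (b - a)) by module]
    exact (IsSelfAdjoint.all _).smul (IsSelfAdjoint.of_nonneg (add_nonneg hadd hsub))
  have ha : IsSelfAdjoint a := by
    simpa using (IsSelfAdjoint.of_nonneg hadd).sub hb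
  have hle : a ≤ algebraMap ℝ A ‖b‖ := (sub_nonneg.mp hsub).trans hb.le_algebraMap_norm_self
  have hneg : -a ≤ algebraMap ℝ A ‖b‖ :=
    (neg_le_iff_add_nonneg.mpr hadd).trans hb.le_algebraMap_norm_self
  rw [le_algebraMap_iff_spectrum_le] at hle hneg
  rcases CStarAlgebra.norm_or_neg_norm_mem_spectrum ha with h | h
  · exact hle _ h
  · refine hneg _ ?_
    rw [← spectrum.neg_eq]
    simpa using h

section Incomplete

variable {A : Type*} [NormedRing A] [StarRing A] [CStarRing A] [PartialOrder A]
  [StarOrderedRing A] [NormedAlgebra ℂ A]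

theorem star_algebraMap_I {A : Type*} [NormedRing A] [StarRing A] [PartialOrder A]
    [StarOrderedRing A] [NormedAlgebra ℂ A] :
    star (algebraMap ℂ A Complex.I) = -algebraMap ℂ A Complex.I := by
  set j := algebraMap ℂ A Complex.I with hj
  have hjj : j * j = -1 := by rw [hj, ← map_mul]; simp
  have hcomm : ∀ x, j * x = x * j := Algebra.commutes _
  have hss : star j * star j = -1 := by rw [← star_mul, hjj]; simp
  set p := star j * j with hp
  have hpp : p * p = 1 := by
    rw [hp, mul_assoc, ← mul_assoc j, hcomm (star j), mul_assoc (star j), hjj, ← mul_assoc, hss]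
    simp
  have hpsa : star p = p := by simp [hp]
  have hge : 0 ≤ (1 - p) + (1 - p) := by
    have h := star_mul_self_nonneg (1 - p)
    rwa [star_sub, star_one, hpsa, show (1 - p) * (1 - p) = (1 - p) + (1 - p) by
      rw [mul_sub, sub_mul, sub_mul, hpp]; noncomm_ring] at h
  have hle : 0 ≤ -((1 - p) + (1 - p)) := by
    have h := star_left_conjugate_nonneg (star_mul_self_nonneg j) (1 - p)
    rwa [← hp, star_sub, star_one, hpsa, show (1 - p) * p * (1 - p) = -((1 - p) + (1 - p)) by
      rw [sub_mul 1 p p, hpp, one_mul, mul_sub, sub_mul p 1 p, hpp]; noncomm_ring] at h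
  have hzero : (2 : ℂ) • (1 - p) = 0 := by
    rw [two_smul]; exact le_antisymm (neg_nonneg.mp hle) hge
  have hp1 : p = 1 := (sub_eq_zero.mp ((smul_eq_zero_iff_right two_ne_zero).mp hzero)).symm
  calc star j = -(star j * (j * j)) := by rw [hjj]; simp
    _ = -j := by rw [← mul_assoc, ← hp, hp1, one_mul]

theorem star_algebraMap_complex (c : ℂ) :
    star (algebraMap ℂ A c) = algebraMap ℂ A (conj c) := by
  let f : ℂ →+ A := (starAddEquiv : A ≃+ A).toAddMonoidHom.comp (algebraMap ℂ A).toAddMonoidHom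
  let g : ℂ →+ A := (algebraMap ℂ A).toAddMonoidHom.comp (starRingEnd ℂ).toAddMonoidHom
  have hf : Continuous f := continuous_star.comp (algebraMapCLM ℂ A).continuous
  have hg : Continuous g := (algebraMapCLM ℂ A).continuous.comp Complex.continuous_conj
  have hfg : f.toRealLinearMap hf = g.toRealLinearMap hg := by
    refine ContinuousLinearMap.coe_injective (Complex.basisOneI.ext fun i => ?_)
    fin_cases i
    · simp [f, g]
    · simp [f, g, star_algebraMap_I]
  exact DFunLike.congr_fun hfg c

variable (A) in
theorem StarModule.complex_of_starOrderedRing : StarModule ℂ A where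
  star_smul c x := by
    rw [Algebra.smul_def, star_mul, star_algebraMap_complex, Algebra.smul_def, Algebra.commutes]
    rfl

/-- The implication `-b ≤ a ≤ b → ‖a‖ ≤ ‖b‖` without completeness. -/
theorem norm_le_norm_of_add_nonneg_of_sub_nonneg {a b : A} (hadd : 0 ≤ b + a)
    (hsub : 0 ≤ b - a) : ‖a‖ ≤ ‖b‖ := by
  have := StarModule.complex_of_starOrderedRing A
  let _ := CStarAlgebra.spectralOrder (Completion A)
  have := CStarAlgebra.spectralOrderedRing (Completion A)
  have hcoe : ∀ x : A, 0 ≤ x → 0 ≤ (x : Completion A) := by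
    intro x hx
    rw [StarOrderedRing.nonneg_iff] at hx
    induction hx using AddSubmonoid.closure_induction with
    | mem x hx =>
      obtain ⟨s, rfl⟩ := hx
      rw [Completion.coe_mul, Completion.coe_star]
      exact star_mul_self_nonneg _
    | zero => exact le_rfl
    | add x y _ _ hx hy => rw [Completion.coe_add]; exact add_nonneg hx hy
  rw [← Completion.norm_coe a, ← Completion.norm_coe b]
  refine CStarAlgebra.norm_le_norm_of_add_nonneg_of_sub_nonneg ?_ ?_
  · simpa only [Completion.coe_add] using hcoe _ hadd
  · simpa only [Completion.coe_sub] using hcoe _ hsub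

/-- A Cauchy–Schwarz type bound for the difference of two positive algebra-valued
sesquilinear forms. -/
theorem norm_sub_le_of_nonneg_sesquilinear {E : Type*} [AddCommGroup E] [Module ℂ E]
    (D F : E →ₗ⋆[ℂ] E →ₗ[ℂ] A) (hD : ∀ x, 0 ≤ D x x) (hF : ∀ x, 0 ≤ F x x) (x y : E) :
    ‖D x y - F x y‖ ≤ ‖D x x + F x x‖ + ‖D y y + F y y‖ := by
  have hsymm : ∀ x y, ‖(D x y - F x y) + (D y x - F y x)‖ ≤
      ‖D x x + F x x‖ + ‖D y y + F y y‖ := by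
    intro x y
    have h : ‖(2 : ℂ) • ((D x y - F x y) + (D y x - F y x))‖ ≤
        ‖(2 : ℂ) • ((D x x + F x x) + (D y y + F y y))‖ := by
      apply norm_le_norm_of_add_nonneg_of_sub_nonneg
      · convert add_nonneg (add_nonneg (hD (x + y)) (hD (x + y)))
          (add_nonneg (hF (x - y)) (hF (x - y))) using 1
        simp only [map_add, map_sub, LinearMap.add_apply, LinearMap.sub_apply]
        module
      · convert add_nonneg (add_nonneg (hD (x - y)) (hD (x - y)))
          (add_nonneg (hF (x + y)) (hF (x + y))) using 1
        simp only [map_add, map_sub, LinearMap.add_apply, LinearMap.sub_apply]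
        module
    rw [norm_smul, norm_smul] at h
    exact (le_of_mul_le_mul_left h (by simp)).trans (norm_add_le _ _)
  have hI := hsymm x (Complex.I • y)
  simp only [map_smul, LinearMap.map_smulₛₗ, LinearMap.smul_apply, smul_smul, Complex.conj_I,
    mul_neg, Complex.I_mul_I, neg_neg, one_smul] at hI
  have hdecomp : (2 : ℂ) • (D x y - F x y) = ((D x y - F x y) + (D y x - F y x)) +
      (-Complex.I) • ((Complex.I • D x y - Complex.I • F x y) +
        (-Complex.I • D y x - -Complex.I • F y x)) := by
    simp only [smul_add, smul_sub, smul_smul, mul_neg, neg_mul, Complex.I_mul_I, neg_neg]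
    module
  have h2 : ‖(2 : ℂ) • (D x y - F x y)‖ ≤ 2 * (‖D x x + F x x‖ + ‖D y y + F y y‖) := by
    rw [hdecomp, two_mul]
    refine (norm_add_le _ _).trans (add_le_add (hsymm x y) ?_)
    rw [norm_smul]
    simpa using hI
  rw [norm_smul, Complex.norm_ofNat] at h2
  linarith

end Incomplete

/-- A linear map satisfying the operator Schwarz inequality is positive. -/
theorem map_nonneg_of_schwarz {A B : Type*} [Ring A] [StarRing A] [PartialOrder A]
    [StarOrderedRing A] [Ring B] [StarRing B] [PartialOrder B] [StarOrderedRing B]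
    (α : B →+ A) (hα : ∀ y, star (α y) * α y ≤ α (star y * y)) {y : B} (hy : 0 ≤ y) :
    0 ≤ α y := by
  rw [StarOrderedRing.nonneg_iff] at hy
  induction hy using AddSubmonoid.closure_induction with
  | mem y hy =>
    obtain ⟨s, rfl⟩ := hy
    exact (star_mul_self_nonneg _).trans (hα s)
  | zero => simp
  | add x y _ _ hx hy => rw [map_add]; exact add_nonneg hx hy


/-- Lemma 8.7 (k = 2 case): for unital star-preserving contractive maps `β : A → B`,
`α : B → A` satisfying the operator Schwarz inequality with `‖α(β(x)) − x‖ ≤ ε‖x‖`,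
one has `‖α(β(n₁)β(n₂)) − n₁n₂‖ ≤ 5ε‖n₁‖‖n₂‖`. -/
theorem approx_recovery_approx_homomorphism_pairs
    {A B : Type*}
    [NormedRing A] [StarRing A] [CStarRing A] [PartialOrder A] [StarOrderedRing A]
    [NormedAlgebra ℂ A]
    [NormedRing B] [StarRing B] [CStarRing B] [PartialOrder B] [StarOrderedRing B]
    [NormedAlgebra ℂ B]
    (β : A →ₗ[ℂ] B) (α : B →ₗ[ℂ] A)
    (hβ1 : β 1 = 1) (hα1 : α 1 = 1)
    (hβstar : ∀ x, β (star x) = star (β x)) (hαstar : ∀ y, α (star y) = star (α y))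
    (hβcon : ∀ x, ‖β x‖ ≤ ‖x‖) (hαcon : ∀ y, ‖α y‖ ≤ ‖y‖)
    (hβsch : ∀ x, star (β x) * β x ≤ β (star x * x))
    (hαsch : ∀ y, star (α y) * α y ≤ α (star y * y))
    (ε : ℝ)
    (hrec : ∀ x, ‖α (β x) - x‖ ≤ ε * ‖x‖) :
    ∀ n₁ n₂ : A, ‖α (β n₁ * β n₂) - n₁ * n₂‖ ≤ 5 * ε * ‖n₁‖ * ‖n₂‖ := by
  have := StarModule.complex_of_starOrderedRing A
  let D : A →ₗ⋆[ℂ] A →ₗ[ℂ] A := LinearMap.mk₂'ₛₗ (starRingEnd ℂ) (RingHom.id ℂ)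
    (fun x y => α (β (star x) * β y) - α (β (star x)) * α (β y))
    (by intros; simp only [star_add, map_add, add_mul]; abel)
    (by intros; simp [star_smul, smul_sub])
    (by intros; simp only [map_add, mul_add]; abel)
    (by intros; simp [smul_sub])
  let F : A →ₗ⋆[ℂ] A →ₗ[ℂ] A := LinearMap.mk₂'ₛₗ (starRingEnd ℂ) (RingHom.id ℂ)
    (fun x y => α (β (star x * y)) - α (β (star x) * β y))
    (by intros; simp only [star_add, map_add, add_mul]; abel)
    (by intros; simp [star_smul, smul_sub])
    (by intros; simp only [map_add, mul_add]; abel)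
    (by intros; simp [smul_sub])
  have hDdef : ∀ x y, D x y = α (β (star x) * β y) - α (β (star x)) * α (β y) := fun _ _ => rfl
  have hFdef : ∀ x y, F x y = α (β (star x * y)) - α (β (star x) * β y) := fun _ _ => rfl
  have hD : ∀ x, 0 ≤ D x x := fun x => by
    rw [hDdef, hβstar, hαstar]
    exact sub_nonneg.mpr (hαsch _)
  have hF : ∀ x, 0 ≤ F x x := fun x => by
    rw [hFdef, hβstar, ← map_sub]
    exact map_nonneg_of_schwarz α.toAddMonoidHom hαsch (sub_nonneg.mpr (hβsch x))
  have hprod : ∀ x y, ‖x‖ = 1 → ‖y‖ = 1 → ‖α (β (x * y)) - x * y‖ ≤ ε ∧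
      ‖α (β x) * α (β y) - x * y‖ ≤ 2 * ε := by
    intro x y hx hy
    have hε : 0 ≤ ε := by simpa [hx] using (norm_nonneg _).trans (hrec x)
    have hrx : ‖α (β x) - x‖ ≤ ε := by simpa [hx] using hrec x
    have hry : ‖α (β y) - y‖ ≤ ε := by simpa [hy] using hrec y
    have hcx : ‖α (β x)‖ ≤ 1 := ((hαcon _).trans (hβcon _)).trans hx.le
    constructor
    · refine (hrec _).trans (mul_le_of_le_one_right hε ?_)
      simpa [hx, hy] using norm_mul_le x y
    · calc ‖α (β x) * α (β y) - x * y‖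
          = ‖α (β x) * (α (β y) - y) + (α (β x) - x) * y‖ := by
            rw [mul_sub, sub_mul]; congr 1; abel
        _ ≤ ‖α (β x)‖ * ‖α (β y) - y‖ + ‖α (β x) - x‖ * ‖y‖ :=
            (norm_add_le _ _).trans (add_le_add (norm_mul_le _ _) (norm_mul_le _ _))
        _ ≤ 1 * ε + ε * 1 := by rw [hy]; gcongr
        _ = 2 * ε := by ring
  have hdiag : ∀ x, ‖x‖ = 1 → ‖D x x + F x x‖ ≤ 3 * ε := by
    intro x hx
    obtain ⟨h₁, h₂⟩ := hprod (star x) x (by rw [norm_star, hx]) hx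
    calc ‖D x x + F x x‖ = ‖(α (β (star x * x)) - star x * x) -
          (α (β (star x)) * α (β x) - star x * x)‖ := by
            rw [hDdef, hFdef]; congr 1; abel
      _ ≤ 3 * ε := (norm_sub_le _ _).trans (by linarith)
  have hunit : ∀ x y, ‖x‖ = 1 → ‖y‖ = 1 → ‖α (β x * β y) - x * y‖ ≤ 5 * ε := by
    intro x y hx hy
    have hx' : ‖star x‖ = 1 := by rw [norm_star, hx]
    have hε : 0 ≤ ε := by simpa [hx] using (norm_nonneg _).trans (hrec x)
    obtain ⟨h₁, h₂⟩ := hprod x y hx hy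
    have hDF := norm_sub_le_of_nonneg_sesquilinear D F hD hF (star x) y
    have hdx := hdiag (star x) hx'
    have hdy := hdiag y hy
    have heq : (2 : ℂ) • (α (β x * β y) - x * y) = (D (star x) y - F (star x) y) +
        (α (β (x * y)) - x * y) + (α (β x) * α (β y) - x * y) := by
      rw [hDdef, hFdef, star_star]; module
    have hnorm : ‖(2 : ℂ) • (α (β x * β y) - x * y)‖ ≤ 9 * ε := by
      rw [heq]
      exact norm_add₃_le.trans (by linarith)
    rw [norm_smul, Complex.norm_ofNat] at hnorm
    linarith
  intro x y
  rcases eq_or_ne x 0 with rfl | hx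
  · simp
  rcases eq_or_ne y 0 with rfl | hy
  · simp
  have hx0 : (‖x‖ : ℂ) ≠ 0 := by simpa using hx
  have hy0 : (‖y‖ : ℂ) ≠ 0 := by simpa using hy
  have h := hunit ((‖x‖⁻¹ : ℂ) • x) ((‖y‖⁻¹ : ℂ) • y) (norm_smul_inv_norm hx)
    (norm_smul_inv_norm hy)
  simp only [map_smul, smul_mul_assoc, mul_smul_comm, ← smul_sub, norm_smul, norm_inv,
    Complex.norm_real, norm_norm] at h
  have hxp : 0 < ‖x‖ := norm_pos_iff.mpr hx
  have hyp : 0 < ‖y‖ := norm_pos_iff.mpr hy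
  rw [inv_mul_le_iff₀ (by assumption), inv_mul_le_iff₀ (by assumption)] at h
  linarith
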